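/- Let H be a quaternionic Hilbert space, let T ∈ B(H) be normal, let s ∈ ρ_S(T), and assume σ_S(T) is nonempty. Then ‖𝒬_s(T)⁻¹‖ ≤ 1/d², where d := inf{‖w − p‖ : w ∈ σ_S(T), p ∈ [s]} is the distance between the S-spectrum σ_S(T) and the 2-sphere [s]. -/

import Mathlib

noncomputable section
notation "ℍ" => Quaternion ℝ

/-- The 2-sphere `[s]` of a quaternion `s`. -/
def sphereOf (s : ℍ) : Set ℍ := {p | p.re = s.re ∧ ‖p‖ = ‖s‖}

variable {H : Type*} [NormedAddCommGroup H] [InnerProductSpace ℝ H] [CompleteSpace H]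
  [Module ℍ H] [IsScalarTower ℝ ℍ H] [SMulCommClass ℝ ℍ H] [SMulCommClass ℍ ℝ H]

/-- The pseudo-resolvent second-order operator `𝒬_s(T) = T² − 2(Re s)·T + ‖s‖²·I`. -/
def QOp (T : H →L[ℍ] H) (s : ℍ) : H →L[ℍ] H :=
  T ∘L T - (2 * s.re) • T + (‖s‖ ^ 2) • (1 : H →L[ℍ] H)

/-- The S-spectrum of `T`. -/
def sSpectrum (T : H →L[ℍ] H) : Set ℍ := {s | ¬ IsUnit (QOp T s)}

/-- The operator norm of a bounded quaternionic linear operator. -/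
def opNormQ (T : H →L[ℍ] H) : ℝ := ‖T.restrictScalars ℝ‖

/-- The adjoint of `T`, as a bounded real-linear operator on the underlying real
Hilbert space. -/
def radjoint (T : H →L[ℍ] H) : H →L[ℝ] H :=
  ContinuousLinearMap.adjoint (T.restrictScalars ℝ)

/-- `T` is normal if it commutes with its adjoint. -/
def IsNormalOp (T : H →L[ℍ] H) : Prop :=
  (T.restrictScalars ℝ) ∘L radjoint T = radjoint T ∘L (T.restrictScalars ℝ)

set_option linter.unusedSectionVars false

theorem continuous_re_sub_smul_add_norm_smul {A : Type*} [NormedRing A] [NormedAlgebra ℝ A]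
    (a : A) : Continuous fun s : ℍ ↦ a * a - (2 * s.re) • a + (‖s‖ ^ 2) • (1 : A) := by
  have := Quaternion.continuous_re
  fun_prop

theorem isUnit_of_isUnit_restrictScalars {T : H →L[ℍ] H} (h : IsUnit (T.restrictScalars ℝ)) :
    IsUnit T := by
  obtain ⟨u, hu⟩ := h
  set S : H →L[ℝ] H := ↑u⁻¹
  have hl (x : H) : S (T x) = x := by
    have := DFunLike.congr_fun u.inv_mul x
    rw [hu] at this
    exact this
  have hr (x : H) : T (S x) = x := by
    have := DFunLike.congr_fun u.mul_inv x
    rw [hu] at this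
    exact this
  let S' : H →L[ℍ] H :=
    { toFun := S
      map_add' := map_add S
      map_smul' := fun q x ↦ by
        conv_lhs => rw [← hr x, ← map_smul, hl]
        rfl
      cont := S.continuous }
  exact ⟨⟨T, S', ContinuousLinearMap.ext hr, ContinuousLinearMap.ext hl⟩, rfl⟩

theorem isUnit_restrictScalars_iff {T : H →L[ℍ] H} :
    IsUnit (T.restrictScalars ℝ) ↔ IsUnit T := by
  refine ⟨isUnit_of_isUnit_restrictScalars, ?_⟩
  rintro ⟨u, rfl⟩
  refine ⟨⟨(u : H →L[ℍ] H).restrictScalars ℝ, (↑u⁻¹ : H →L[ℍ] H).restrictScalars ℝ, ?_, ?_⟩, rfl⟩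
  · ext x
    exact DFunLike.congr_fun u.mul_inv x
  · ext x
    exact DFunLike.congr_fun u.inv_mul x

theorem isClosed_sSpectrum (T : H →L[ℍ] H) : IsClosed (sSpectrum T) := by
  have h : sSpectrum T = (fun s : ℍ ↦ T.restrictScalars ℝ * T.restrictScalars ℝ -
      (2 * s.re) • T.restrictScalars ℝ + (‖s‖ ^ 2) • (1 : H →L[ℝ] H)) ⁻¹' nonunits _ := by
    ext s
    exact not_congr isUnit_restrictScalars_iff.symm
  rw [h]
  exact nonunits.isClosed.preimage (continuous_re_sub_smul_add_norm_smul _)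

theorem isCompact_sphereOf (s : ℍ) : IsCompact (sphereOf s) := by
  refine (isCompact_closedBall (0 : ℍ) ‖s‖).of_isClosed_subset ?_ fun p hp ↦ by simp [hp.2]
  exact (isClosed_eq Quaternion.continuous_re continuous_const).inter
    (isClosed_eq continuous_norm continuous_const)

theorem QOp_eq_of_mem_sphereOf (T : H →L[ℍ] H) {s p : ℍ} (hp : p ∈ sphereOf s) :
    QOp T p = QOp T s := by
  simp only [QOp, hp.1, hp.2]

theorem sInf_norm_sub_pos {T : H →L[ℍ] H} {s : ℍ} (hs : s ∉ sSpectrum T)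
    (hne : (sSpectrum T).Nonempty) :
    0 < sInf {r : ℝ | ∃ w ∈ sSpectrum T, ∃ p ∈ sphereOf s, ‖w - p‖ = r} := by
  obtain ⟨p, hp, hmin⟩ := (isCompact_sphereOf s).exists_isMinOn ⟨s, rfl, rfl⟩
    (Metric.continuous_infDist_pt (sSpectrum T)).continuousOn
  have hp' : p ∉ sSpectrum T := by
    simpa only [sSpectrum, Set.mem_ofPred_eq, QOp_eq_of_mem_sphereOf T hp] using hs
  refine (((isClosed_sSpectrum T).notMem_iff_infDist_pos hne).1 hp').trans_le
    (le_csInf ?_ ?_)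
  · obtain ⟨w, hw⟩ := hne
    exact ⟨_, w, hw, s, ⟨rfl, rfl⟩, rfl⟩
  · rintro _ ⟨w, hw, p', hp', rfl⟩
    refine (hmin hp').trans ?_
    rw [← dist_eq_norm, dist_comm]
    exact Metric.infDist_le_dist_of_mem hw

theorem norm_coeComplex (z : ℂ) : ‖(z : ℍ)‖ = ‖z‖ := by
  rw [← sq_eq_sq₀ (norm_nonneg _) (norm_nonneg _), sq ‖(_ : ℍ)‖,
    ← Quaternion.normSq_eq_norm_mul_self, Quaternion.normSq_def', Complex.sq_norm, Complex.normSq_apply]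
  simp [sq]

/-- The point of `[s]` in the closed upper half of the complex plane. -/
def sphereRep (s : ℍ) : ℂ := ⟨s.re, √(‖s‖ ^ 2 - s.re ^ 2)⟩

theorem norm_sphereRep (s : ℍ) : ‖sphereRep s‖ = ‖s‖ := by
  have h : 0 ≤ ‖s‖ ^ 2 - s.re ^ 2 := by
    rw [sq ‖(_ : ℍ)‖, ← Quaternion.normSq_eq_norm_mul_self, Quaternion.normSq_def']
    nlinarith [sq_nonneg s.imI, sq_nonneg s.imJ, sq_nonneg s.imK]
  rw [← sq_eq_sq₀ (norm_nonneg _) (norm_nonneg _), Complex.sq_norm, Complex.normSq_apply,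
    sphereRep, Real.mul_self_sqrt h]
  ring

theorem coe_sphereRep_mem (s : ℍ) : (sphereRep s : ℍ) ∈ sphereOf s :=
  ⟨rfl, by rw [norm_coeComplex, norm_sphereRep]⟩

theorem coe_conj_sphereRep_mem (s : ℍ) :
    (((starRingEnd ℂ) (sphereRep s) : ℂ) : ℍ) ∈ sphereOf s :=
  ⟨rfl, by rw [norm_coeComplex, Complex.norm_conj, norm_sphereRep]⟩

theorem mul_sub_two_re_mul_add_norm_sq {A : Type*} [Ring A] [Algebra ℂ A] (a : A) (z : ℂ) :
    a * a - ((2 * z.re : ℝ) : ℂ) • a + ((‖z‖ ^ 2 : ℝ) : ℂ) • (1 : A) =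
      (a - algebraMap ℂ A z) * (a - algebraMap ℂ A (starRingEnd ℂ z)) := by
  have h₁ : ((2 * z.re : ℝ) : ℂ) = z + starRingEnd ℂ z := by
    rw [Complex.add_conj]
  have h₂ : ((‖z‖ ^ 2 : ℝ) : ℂ) = z * starRingEnd ℂ z := by
    rw [Complex.mul_conj, Complex.normSq_eq_norm_sq]
  rw [h₁, h₂, sub_mul, mul_sub, mul_sub, ← map_mul, ← Algebra.commutes _ a, ← Algebra.smul_def,
    ← Algebra.smul_def, Algebra.algebraMap_eq_smul_one, add_smul]
  abel

/-- A quaternionic space, regarded as a complex space through the inclusion of `ℂ` in `ℍ`. -/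
def ComplexSlice (H : Type*) : Type _ := H

namespace ComplexSlice

/-- The underlying vector of the quaternionic space. -/
def val {H : Type*} (x : ComplexSlice H) : H := x

instance : NormedAddCommGroup (ComplexSlice H) := inferInstanceAs (NormedAddCommGroup H)

instance : CompleteSpace (ComplexSlice H) := inferInstanceAs (CompleteSpace H)

instance : Module ℂ (ComplexSlice H) :=
  Module.compHom H (Quaternion.ofComplex : ℂ →ₐ[ℝ] ℍ).toRingHom

variable [NormSMulClass ℍ H]

instance : NormedSpace ℂ (ComplexSlice H) where
  norm_smul_le z x := by
    refine (norm_smul (z : ℍ) x.val).le.trans_eq ?_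
    rw [norm_coeComplex]
    rfl

instance : InnerProductSpace ℂ (ComplexSlice H) :=
  InnerProductSpace.ofNorm ℂ fun x y ↦ parallelogram_law_with_norm_mul ℝ x.val y.val

theorem re_inner_eq (x y : ComplexSlice H) :
    (inner ℂ x y).re = inner ℝ x.val y.val := by
  refine (re_inner_eq_norm_add_mul_self_sub_norm_mul_self_sub_norm_mul_self_div_two (𝕜 := ℂ)
    x y).trans ?_
  rw [real_inner_eq_norm_add_mul_self_sub_norm_mul_self_sub_norm_mul_self_div_two]
  rfl

/-- A quaternionic operator, regarded as a complex operator. -/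
def ofOp (T : H →L[ℍ] H) : ComplexSlice H →L[ℂ] ComplexSlice H where
  toFun := T
  map_add' := map_add T
  map_smul' z x := map_smul T (z : ℍ) x.val
  cont := T.continuous

theorem isUnit_ofOp {T : H →L[ℍ] H} (h : IsUnit T) : IsUnit (ofOp T) := by
  obtain ⟨u, rfl⟩ := h
  exact ⟨⟨ofOp u, ofOp (↑u⁻¹ : H →L[ℍ] H),
    ContinuousLinearMap.ext fun x ↦ DFunLike.congr_fun u.mul_inv x,
    ContinuousLinearMap.ext fun x ↦ DFunLike.congr_fun u.inv_mul x⟩, rfl⟩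

theorem ofOp_inverse {T : H →L[ℍ] H} (h : IsUnit T) :
    ofOp (Ring.inverse T) = Ring.inverse (ofOp T) := by
  refine (isUnit_ofOp h).mul_left_cancel ?_
  rw [Ring.mul_inverse_cancel _ (isUnit_ofOp h)]
  exact ContinuousLinearMap.ext fun x ↦ DFunLike.congr_fun (Ring.mul_inverse_cancel _ h) x

theorem ofOp_QOp (T : H →L[ℍ] H) (s : ℍ) :
    ofOp (QOp T s) = ofOp T * ofOp T - ((2 * s.re : ℝ) : ℂ) • ofOp T +
      ((‖s‖ ^ 2 : ℝ) : ℂ) • (1 : ComplexSlice H →L[ℂ] ComplexSlice H) := by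
  have h (r : ℝ) (x : H) : r • x = (((r : ℂ) : ℍ)) • x := by
    rw [Quaternion.coeComplex_coe, ← Quaternion.algebraMap_def, algebraMap_smul]
  refine ContinuousLinearMap.ext fun x ↦ ?_
  change T (T x.val) - (2 * s.re) • T x.val + (‖s‖ ^ 2) • x.val = _
  rw [h, h]
  rfl

theorem norm_ofOp (T : H →L[ℍ] H) : ‖ofOp T‖ = opNormQ T :=
  le_antisymm
    ((ofOp T).opNorm_le_bound (norm_nonneg _) fun x ↦ (T.restrictScalars ℝ).le_opNorm x)
    ((T.restrictScalars ℝ).opNorm_le_bound (norm_nonneg _) fun x ↦ (ofOp T).le_opNorm x)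

theorem adjoint_ofOp_apply (T : H →L[ℍ] H) (x : ComplexSlice H) :
    (ContinuousLinearMap.adjoint (ofOp T) x).val = radjoint T x.val := by
  have h (y : ComplexSlice H) : inner ℝ (ContinuousLinearMap.adjoint (ofOp T) x).val y.val =
      inner ℝ (radjoint T x.val) y.val := by
    rw [← re_inner_eq, ContinuousLinearMap.adjoint_inner_left, re_inner_eq, radjoint,
      ContinuousLinearMap.adjoint_inner_left]
    rfl
  exact ext_inner_right ℝ h

theorem isStarNormal_ofOp {T : H →L[ℍ] H} (hT : IsNormalOp T) : IsStarNormal (ofOp T) := by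
  refine ⟨ContinuousLinearMap.ext fun x ↦ ?_⟩
  change (ContinuousLinearMap.adjoint (ofOp T) (ofOp T x)).val =
    T (ContinuousLinearMap.adjoint (ofOp T) x).val
  rw [adjoint_ofOp_apply, adjoint_ofOp_apply]
  exact DFunLike.congr_fun hT.symm x.val

theorem coe_mem_sSpectrum {T : H →L[ℍ] H} {z : ℂ} (hz : z ∈ spectrum ℂ (ofOp T)) :
    (z : ℍ) ∈ sSpectrum T := by
  intro h
  have h' := isUnit_ofOp h
  rw [ofOp_QOp, Quaternion.re_coeComplex, norm_coeComplex, mul_sub_two_re_mul_add_norm_sq] at h'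
  have hcomm : Commute (ofOp T - algebraMap ℂ _ z)
      (ofOp T - algebraMap ℂ _ (starRingEnd ℂ z)) :=
    ((Commute.refl _).sub_right (Algebra.commute_algebraMap_right _ _)).sub_left
      (Algebra.commute_algebraMap_left _ _)
  rw [spectrum.mem_iff, ← IsUnit.neg_iff, neg_sub] at hz
  exact hz (hcomm.isUnit_mul_iff.1 h').1

end ComplexSlice

/-- In a C⋆-algebra, a lower bound of a quadratic polynomial on the spectrum of a normal element
bounds the norm of the inverse of its value at that element. -/
theorem norm_inverse_quadratic_le {A : Type*} [CStarAlgebra A] {a : A} (ha : IsStarNormal a)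
    (b c : ℂ) {δ : ℝ} (hδ : 0 < δ)
    (h : ∀ z ∈ spectrum ℂ a, δ ≤ ‖z * z - b * z + c‖) :
    ‖Ring.inverse (a * a - b • a + c • (1 : A))‖ ≤ 1 / δ := by
  have hq : cfc (fun z : ℂ ↦ z * z - b * z + c) a = a * a - b • a + c • (1 : A) := by
    rw [cfc_add .., cfc_sub .., cfc_mul .., cfc_const_mul .., cfc_id' .., cfc_const ..,
      Algebra.algebraMap_eq_smul_one]
  have h0 : ∀ z ∈ spectrum ℂ a, z * z - b * z + c ≠ 0 := fun z hz ↦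
    norm_pos_iff.1 (hδ.trans_le (h z hz))
  rw [← hq, ← cfc_inv _ a h0]
  refine norm_cfc_le (by positivity) fun z hz ↦ ?_
  rw [norm_inv, ← one_div]
  exact one_div_le_one_div_of_le hδ (h z hz)

/-- For a normal operator `T` and `s` in the S-resolvent set, the inverse of the
pseudo-resolvent is bounded by the reciprocal of the squared distance from the
S-spectrum to the sphere `[s]`. -/
theorem opNorm_inverse_QOp_le (T : H →L[ℍ] H)
    (hnorm : ∀ (q : ℍ) (x : H), ‖q • x‖ = ‖q‖ * ‖x‖)
    (hT : IsNormalOp T) (s : ℍ) (hs : s ∉ sSpectrum T)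
    (hne : (sSpectrum T).Nonempty) :
    opNormQ (Ring.inverse (QOp T s)) ≤
      1 / (sInf {r : ℝ | ∃ w ∈ sSpectrum T, ∃ p ∈ sphereOf s, ‖w - p‖ = r}) ^ 2 := by
  have : NormSMulClass ℍ H := ⟨hnorm⟩
  have hd := sInf_norm_sub_pos hs hne
  set d := sInf {r : ℝ | ∃ w ∈ sSpectrum T, ∃ p ∈ sphereOf s, ‖w - p‖ = r}
  rw [← ComplexSlice.norm_ofOp, ComplexSlice.ofOp_inverse (not_not.1 hs), ComplexSlice.ofOp_QOp]
  refine norm_inverse_quadratic_le (ComplexSlice.isStarNormal_ofOp hT) _ _ (by positivity)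
    fun z hz ↦ ?_
  have hle {p : ℂ} (hp : (p : ℍ) ∈ sphereOf s) : d ≤ ‖z - p‖ := by
    refine csInf_le ⟨0, ?_⟩ ⟨z, ComplexSlice.coe_mem_sSpectrum hz, p, hp, ?_⟩
    · rintro _ ⟨_, _, _, _, rfl⟩
      exact norm_nonneg _
    · rw [← norm_coeComplex]
      congr 1
      ext <;> simp
  have hfac := mul_sub_two_re_mul_add_norm_sq z (sphereRep s)
  rw [norm_sphereRep, smul_eq_mul, smul_eq_mul, mul_one] at hfac
  refine le_of_le_of_eq ?_ (congrArg norm hfac).symm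
  rw [norm_mul, sq]
  exact mul_le_mul (hle (coe_sphereRep_mem s)) (hle (coe_conj_sphereRep_mem s)) hd.le
    (norm_nonneg _)
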